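/- Let f : ℝ³ → ℝ³ be given by f(a, b, c) = (b, c^{1/3}, a³ + b³) (real cube root) and h : ℝ³ → ℝ, h(a, b, c) = a. Then f is bijective, and for every x̂ = (â, b̂, ĉ) ∈ ℝ³ and every y ∈ ℝ, the set [x̂]_1^+ ∩ h⁻¹(y) is the singleton {(y, b̂, ĉ − â³ + y³)}; in particular the singleton condition holds with deadbeat horizon p = 3. -/

import Mathlib

/-- `[x]_k`: `[x]_0 = h⁻¹(h x)`, `[x]_{k+1} = [x]_k⁺ ∩ [x]_0`, where
`[x]_k⁺ = f([f⁻¹(x)]_k)` and `[S]_k = ⋃ z ∈ S, [z]_k`. -/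
def obsSet {X Y : Type*} (f : X → X) (h : X → Y) : ℕ → X → Set X
  | 0, x => h ⁻¹' {h x}
  | k + 1, x => (f '' ⋃ z ∈ f ⁻¹' {x}, obsSet f h k z) ∩ h ⁻¹' {h x}

/-- `[x]_k⁺ := f([f⁻¹(x)]_k)`, with `f⁻¹` the set-valued inverse. -/
def obsSetPlus {X Y : Type*} (f : X → X) (h : X → Y) (k : ℕ) (x : X) : Set X :=
  f '' ⋃ z ∈ f ⁻¹' {x}, obsSet f h k z

/-- `obsSetPlus' f h n x = [x]_{n-1}⁺`, with the convention `[x]_{-1}⁺ = X`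
(so `[x]_{p-2}⁺ = obsSetPlus' f h (p-1) x` for `p ≥ 1`). -/
def obsSetPlus' {X Y : Type*} (f : X → X) (h : X → Y) : ℕ → X → Set X
  | 0, _ => Set.univ
  | n + 1, x => obsSetPlus f h n x

/-- The real cube root. -/
noncomputable def cbrt (t : ℝ) : ℝ := Real.sign t * |t| ^ ((1 : ℝ) / 3)

/-- The example system `f(a,b,c) = (b, c^{1/3}, a³ + b³)`. -/
noncomputable def fEx (x : ℝ × ℝ × ℝ) : ℝ × ℝ × ℝ :=
  (x.2.1, cbrt x.2.2, x.1 ^ 3 + x.2.1 ^ 3)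

/-- The example output map `h(a,b,c) = a`. -/
def hEx (x : ℝ × ℝ × ℝ) : ℝ := x.1

theorem cbrt_cube (t : ℝ) : cbrt t ^ 3 = t := by
  have h1 : (|t| ^ ((1 : ℝ) / 3)) ^ 3 = |t| := by
    rw [← Real.rpow_natCast, ← Real.rpow_mul (abs_nonneg t)]
    norm_num
  unfold cbrt
  rw [mul_pow, h1]
  rcases lt_trichotomy t 0 with h | h | h
  · rw [Real.sign_of_neg h, abs_of_neg h]; ring
  · subst h; simp
  · rw [Real.sign_of_pos h, abs_of_pos h]; ring

theorem cube_inj {a b : ℝ} (h : a ^ 3 = b ^ 3) : a = b :=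
  (Odd.strictMono_pow (by decide : Odd 3)).injective h

theorem cbrt_of_cube (t : ℝ) : cbrt (t ^ 3) = t := cube_inj (cbrt_cube _)

/-- The inverse of `fEx`. -/
noncomputable def gEx (x : ℝ × ℝ × ℝ) : ℝ × ℝ × ℝ :=
  (cbrt (x.2.2 - x.1 ^ 3), x.1, x.2.1 ^ 3)

theorem gf (x : ℝ × ℝ × ℝ) : gEx (fEx x) = x := by
  obtain ⟨a, b, c⟩ := x
  simp [gEx, fEx, cbrt_cube, cbrt_of_cube]

theorem fg (x : ℝ × ℝ × ℝ) : fEx (gEx x) = x := by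
  obtain ⟨a, b, c⟩ := x
  simp [gEx, fEx, cbrt_cube, cbrt_of_cube]

theorem fpre (x : ℝ × ℝ × ℝ) : fEx ⁻¹' {x} = {gEx x} := by
  ext z
  simp only [Set.mem_preimage, Set.mem_singleton_iff]
  exact ⟨fun h => by rw [← h, gf], fun h => by rw [h, fg]⟩

theorem fimg (S : Set (ℝ × ℝ × ℝ)) : fEx '' S = gEx ⁻¹' S :=
  congrFun (Set.image_eq_preimage_of_inverse gf fg) S

theorem main_set (xh : ℝ × ℝ × ℝ) (y : ℝ) :
    obsSetPlus fEx hEx 1 xh ∩ hEx ⁻¹' {y} =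
      {(y, xh.2.1, xh.2.2 - xh.1 ^ 3 + y ^ 3)} := by
  obtain ⟨a, b, c⟩ := xh
  ext ⟨p, q, r⟩
  simp only [obsSetPlus, obsSet, fpre, fimg, Set.iUnion_iUnion_eq_left, Set.mem_inter_iff,
    Set.mem_preimage, Set.mem_singleton_iff, hEx, gEx, Prod.mk.injEq]
  constructor
  · rintro ⟨⟨h1, h2⟩, rfl⟩
    have e1 := congrArg (· ^ 3) h1
    have e2 := congrArg (· ^ 3) h2
    simp only [cbrt_cube] at e1 e2
    exact ⟨rfl, cube_inj (by linarith), by linarith⟩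
  · rintro ⟨rfl, rfl, rfl⟩
    simp [cbrt_cube, hEx, gEx]

/-- For the example system, `f` is bijective and
`[x̂]₁⁺ ∩ h⁻¹(y) = {(y, b̂, ĉ - â³ + y³)}`; in particular the singleton
condition holds with deadbeat horizon `p = 3`. -/
theorem example_singleton :
    Function.Bijective fEx ∧
    (∀ (xh : ℝ × ℝ × ℝ) (y : ℝ),
      obsSetPlus fEx hEx 1 xh ∩ hEx ⁻¹' {y} =
        {(y, xh.2.1, xh.2.2 - xh.1 ^ 3 + y ^ 3)}) ∧
    (∀ (xh : ℝ × ℝ × ℝ) (y : ℝ),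
      ∃ z, obsSetPlus' fEx hEx (3 - 1) xh ∩ hEx ⁻¹' {y} = {z}) := by
  refine ⟨⟨Function.LeftInverse.injective gf, Function.RightInverse.surjective fg⟩,
    main_set, fun xh y => ⟨_, main_set xh y⟩⟩
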